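/- arXiv:2006.08950 — 3 statements merged into one kernel-verified Lean document; each statement's English description precedes it below -/
import Mathlib

section
/- Initial-value instability of deterministic Nesterov AGD (Theorem 4.2 / Theorem H.1): For any L, μ > 0 with L/μ ≥ 25 and any integer K ≥ 1, there exists a differentiable function F : ℝ → ℝ that is L-smooth and μ-strongly convex, and an ε₀ > 0, such that for every ε with 0 < ε < ε₀ there exist initializations w₀, u₀, w₀^{ag}, u₀^{ag} ∈ ℝ with |w₀ − u₀| ≤ ε and |w₀^{ag} − u₀^{ag}| ≤ ε, for which the trajectories {(w_t^{ag}, w_t^{md}, w_t)}_{t=0}^{3K} and {(u_t^{ag}, u_t^{md}, u_t)}_{t=0}^{3K} generated by deterministic AGD on F from (w₀^{ag}, w₀) and (u₀^{ag}, u₀) respectively satisfy |w_{3K} − u_{3K}| ≥ (1/2) ε (1.02)^K and |w_{3K}^{ag} − u_{3K}^{ag}| ≥ ε (1.02)^K. -/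
open MeasureTheory ProbabilityTheory Real
open scoped RealInnerProductSpace BigOperators

/-- A differentiable function whose derivative `f` satisfies `m (y - x) ≤ f y - f x` for `x ≤ y`
lies above its tangent parabolas of curvature `m`. -/
theorem tangent_parabola_le {F f : ℝ → ℝ} {m : ℝ} (hF : ∀ x, HasDerivAt F (f x) x)
    (hf : ∀ x y, x ≤ y → m * (y - x) ≤ f y - f x) (u v : ℝ) :
    F v + f v * (u - v) + m / 2 * (u - v) ^ 2 ≤ F u := by
  have hG : ∀ x, HasDerivAt (fun y => F y - f v * (y - v) - m / 2 * (y - v) ^ 2)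
      (f x - f v - m * (x - v)) x := by
    intro x
    have h1 : HasDerivAt (fun y => y - v) 1 x := (hasDerivAt_id x).sub_const v
    refine (((hF x).sub (h1.const_mul (f v))).sub ((h1.pow 2).const_mul (m / 2))).congr_deriv ?_
    push_cast
    ring
  have hcont : Continuous (fun y => F y - f v * (y - v) - m / 2 * (y - v) ^ 2) :=
    continuous_iff_continuousAt.2 fun x => (hG x).continuousAt
  rcases le_total v u with h | h
  · have hmono : MonotoneOn (fun y => F y - f v * (y - v) - m / 2 * (y - v) ^ 2) (Set.Ici v) := by
      refine monotoneOn_of_deriv_nonneg (convex_Ici v) hcont.continuousOn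
        (fun x _ => (hG x).differentiableAt.differentiableWithinAt) fun x hx => ?_
      rw [interior_Ici] at hx
      rw [(hG x).deriv]
      linarith [hf v x (le_of_lt hx)]
    have := hmono (Set.mem_Ici.2 le_rfl) (Set.mem_Ici.2 h) h
    simp only at this
    linarith
  · have hanti : AntitoneOn (fun y => F y - f v * (y - v) - m / 2 * (y - v) ^ 2) (Set.Iic v) := by
      refine antitoneOn_of_deriv_nonpos (convex_Iic v) hcont.continuousOn
        (fun x _ => (hG x).differentiableAt.differentiableWithinAt) fun x hx => ?_
      rw [interior_Iic] at hx
      rw [(hG x).deriv]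
      linarith [hf x v (le_of_lt hx)]
    have := hanti (Set.mem_Iic.2 h) (Set.mem_Iic.2 le_rfl) h
    simp only at this
    linarith

/-- A differentiable function whose derivative `f` satisfies `f y - f x ≤ M (y - x)` for `x ≤ y`
lies below its tangent parabolas of curvature `M`. -/
theorem le_tangent_parabola {F f : ℝ → ℝ} {M : ℝ} (hF : ∀ x, HasDerivAt F (f x) x)
    (hf : ∀ x y, x ≤ y → f y - f x ≤ M * (y - x)) (u v : ℝ) :
    F u ≤ F v + f v * (u - v) + M / 2 * (u - v) ^ 2 := by
  have := tangent_parabola_le (F := fun x => -F x) (f := fun x => -f x) (m := -M)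
    (fun x => (hF x).neg) (fun x y h => by linarith [hf x y h]) u v
  linarith

/-- A piecewise linear function with slopes `0` and `4` whose graph meets the diagonal at the
points `(-c ^ 3) ^ j` with slope `0`, and at the points `-c ^ 2 * (-c ^ 3) ^ j` and `0` with
slope `4`, for `j < n`. -/
noncomputable def staircase (c : ℝ) : ℕ → ℝ → ℝ
  | 0, x => min 1 (4 * x)
  | n + 1, x => min 1 (min (4 * x + 3 * c ^ 2) (-c ^ 3 * staircase c n (-x / c ^ 3)))

namespace staircase

variable {c : ℝ}

theorem sub_mem (hc : 0 < c) (n : ℕ) {x y : ℝ} (hxy : x ≤ y) :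
    staircase c n x ≤ staircase c n y ∧
      staircase c n y ≤ staircase c n x + 4 * (y - x) := by
  induction n generalizing x y with
  | zero =>
    simp only [staircase]
    grind
  | succ n ih =>
    have he : 0 < c ^ 3 := by positivity
    obtain ⟨h1, h2⟩ := ih (x := -y / c ^ 3) (y := -x / c ^ 3) (by gcongr)
    have h3 : c ^ 3 * staircase c n (-x / c ^ 3) ≤
        c ^ 3 * staircase c n (-y / c ^ 3) + 4 * (y - x) := by
      calc _ ≤ c ^ 3 * (staircase c n (-y / c ^ 3) + 4 * (-x / c ^ 3 - -y / c ^ 3)) := by gcongr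
        _ = _ := by field_simp; ring
    have h4 := mul_le_mul_of_nonneg_left h1 he.le
    simp only [staircase, neg_mul]
    generalize c ^ 3 * staircase c n (-x / c ^ 3) = A at *
    generalize c ^ 3 * staircase c n (-y / c ^ 3) = B at *
    clear h1 h2
    grind

theorem le_line (n : ℕ) (x : ℝ) : staircase c n x ≤ 4 * x + 3 * c ^ 2 := by
  cases n with
  | zero => exact (min_le_right _ _).trans (by nlinarith [sq_nonneg c])
  | succ n => exact (min_le_right _ _).trans (min_le_left _ _)

theorem eq_one (hc : 0 < c) (hc' : c ≤ 1 / 2) (n : ℕ) {x : ℝ} (hx : 1 / 2 ≤ x) :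
    staircase c n x = 1 := by
  cases n with
  | zero => exact min_eq_left (by linarith)
  | succ n =>
    have he : 0 < c ^ 3 := by positivity
    have h1 : c ^ 3 * staircase c n (-x / c ^ 3) ≤ -4 * x + 3 * c ^ 5 := by
      calc _ ≤ c ^ 3 * (4 * (-x / c ^ 3) + 3 * c ^ 2) := by gcongr; exact le_line n _
        _ = _ := by field_simp
    have h2 : c ^ 5 ≤ (1 / 2) ^ 5 := by gcongr
    refine min_eq_left (le_min ?_ ?_)
    · nlinarith [sq_nonneg c]
    · norm_num at h2
      linarith

theorem succ_eq (hc : 0 < c) (hc' : c ≤ 1 / 2) (n : ℕ) {x : ℝ} (hx : |-x / c ^ 3| ≤ 9 / 8) :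
    staircase c (n + 1) x = -c ^ 3 * staircase c n (-x / c ^ 3) := by
  have he : 0 < c ^ 3 := by positivity
  have he' : c ^ 3 ≤ (1 / 2) ^ 3 := by gcongr
  obtain ⟨y, hy⟩ : ∃ y, y = -x / c ^ 3 := ⟨_, rfl⟩
  have hxy : x = -c ^ 3 * y := by rw [hy]; field_simp
  rw [← hy] at hx
  obtain ⟨hy1, hy2⟩ := abs_le.1 hx
  have hlow : 4 * y - 7 / 2 ≤ staircase c n y := by
    rcases le_total y 1 with h | h
    · linarith [(sub_mem hc n h).2, eq_one hc hc' n (x := 1) (by norm_num)]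
    · linarith [eq_one hc hc' n (x := y) (by linarith)]
  simp only [staircase, ← hy]
  rw [min_eq_right, min_eq_right]
  · rw [hxy]
    have : c ^ 3 * (4 * y - 7 / 2) ≤ c ^ 3 * staircase c n y := by gcongr
    have h3 : c ^ 3 ≤ c ^ 2 * (1 / 2) := by rw [pow_succ]; gcongr
    nlinarith [sq_nonneg c]
  · refine (min_le_right _ _).trans ?_
    nlinarith

theorem exists_eq_four_mul (hc : 0 < c) (hc' : c ≤ 1 / 2) (n : ℕ) :
    ∃ δ > 0, ∀ x, |x| ≤ δ → staircase c n x = 4 * x := by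
  induction n with
  | zero =>
    exact ⟨1 / 4, by norm_num, fun x hx => min_eq_right (by linarith [le_abs_self x])⟩
  | succ n ih =>
    obtain ⟨δ, hδ, h⟩ := ih
    have he : 0 < c ^ 3 := by positivity
    refine ⟨c ^ 3 * min δ 1, by positivity, fun x hx => ?_⟩
    have hy : |-x / c ^ 3| ≤ min δ 1 := by
      rw [abs_div, abs_neg, abs_of_pos he, div_le_iff₀ he]
      linarith
    rw [succ_eq hc hc' n (hy.trans ((min_le_right _ _).trans (by norm_num))),
      h _ (hy.trans (min_le_left _ _))]
    field_simp

theorem exists_local_form (hc : 0 < c) (hc' : c ≤ 1 / 2) (n : ℕ) :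
    ∃ δ > 0, ∀ j < n, ∀ x,
      (|x - (-c ^ 3) ^ j| ≤ δ → staircase c n x = (-c ^ 3) ^ j) ∧
      (|x| ≤ δ → staircase c n x = 4 * x) ∧
      (|x + c ^ 2 * (-c ^ 3) ^ j| ≤ δ →
        staircase c n x = 4 * x + 3 * (c ^ 2 * (-c ^ 3) ^ j)) := by
  induction n with
  | zero => exact ⟨1, one_pos, fun j hj => absurd hj (Nat.not_lt_zero j)⟩
  | succ n ih =>
    obtain ⟨δ, hδ, h⟩ := ih
    obtain ⟨δ', hδ', h'⟩ := exists_eq_four_mul hc hc' (n + 1)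
    have he : 0 < c ^ 3 := by positivity
    have he' : c ^ 3 ≤ (1 / 2) ^ 3 := by gcongr
    have h3 : c ^ 3 ≤ c ^ 2 * (1 / 2) := by rw [pow_succ]; gcongr
    have h2 : c ^ 2 ≤ (1 / 2) ^ 2 := by gcongr
    refine ⟨min (c ^ 3 * min δ (1 / 8)) δ', by positivity, fun j hj x => ?_⟩
    refine ⟨fun hx => ?_, fun hx => h' x (hx.trans (min_le_right _ _)), fun hx => ?_⟩
    all_goals
      have hx1 := hx.trans (min_le_left _ _)
      have hx2 : c ^ 3 * min δ (1 / 8) ≤ c ^ 3 * (1 / 8) := by gcongr; exact min_le_right _ _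
      rcases j with _ | j
    · obtain ⟨hx3, hx4⟩ := abs_le.1 (hx1.trans hx2)
      simp only [pow_zero] at hx3 ⊢
      exact eq_one hc hc' _ (by linarith)
    · have hr : |(-c ^ 3) ^ j| ≤ 1 := by
        rw [abs_pow, abs_neg, abs_of_pos he]
        exact pow_le_one₀ he.le (by linarith)
      have hy : |-x / c ^ 3 - (-c ^ 3) ^ j| ≤ min δ (1 / 8) := by
        have : -x / c ^ 3 - (-c ^ 3) ^ j = -(x - (-c ^ 3) ^ (j + 1)) / c ^ 3 := by
          field_simp; ring
        rw [this, abs_div, abs_neg, abs_of_pos he, div_le_iff₀ he]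
        linarith
      have hy' := abs_le.1 (hy.trans (min_le_right _ _))
      have hr' := abs_le.1 hr
      rw [succ_eq hc hc' n (abs_le.2 ⟨by linarith, by linarith⟩),
        (h j (by omega) _).1 (hy.trans (min_le_left _ _))]
      ring
    · obtain ⟨hx3, hx4⟩ := abs_le.1 (hx1.trans hx2)
      simp only [pow_zero, mul_one] at hx3 hx4 ⊢
      have : staircase c n (-x / c ^ 3) = 1 := by
        refine eq_one hc hc' n ?_
        rw [le_div_iff₀ he]
        linarith
      simp only [staircase, this]
      rw [min_eq_right, min_eq_left]
      · linarith
      · exact (min_le_right _ _).trans (by linarith)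
    · have hr : |(-c ^ 3) ^ j| ≤ 1 := by
        rw [abs_pow, abs_neg, abs_of_pos he]
        exact pow_le_one₀ he.le (by linarith)
      have hy : |-x / c ^ 3 + c ^ 2 * (-c ^ 3) ^ j| ≤ min δ (1 / 8) := by
        have : -x / c ^ 3 + c ^ 2 * (-c ^ 3) ^ j =
            -(x + c ^ 2 * (-c ^ 3) ^ (j + 1)) / c ^ 3 := by
          field_simp; ring
        rw [this, abs_div, abs_neg, abs_of_pos he, div_le_iff₀ he]
        linarith
      have hy' := abs_le.1 (hy.trans (min_le_right _ _))
      have hr' := abs_le.1 (show |c ^ 2 * (-c ^ 3) ^ j| ≤ 1 by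
        rw [abs_mul, abs_of_nonneg (sq_nonneg c)]
        exact mul_le_one₀ (by linarith) (abs_nonneg _) hr)
      rw [succ_eq hc hc' n (abs_le.2 ⟨by linarith, by linarith⟩),
        (h j (by omega) _).2.2 (hy.trans (min_le_left _ _))]
      field_simp
      ring

theorem continuous (hc : 0 < c) (n : ℕ) : Continuous (staircase c n) := by
  have : LipschitzWith 4 (staircase c n) := by
    refine LipschitzWith.of_le_add_mul 4 fun x y => ?_
    rw [Real.dist_eq]
    push_cast
    rcases le_total x y with h | h
    · linarith [(sub_mem hc n h).1, abs_nonneg (x - y)]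
    · linarith [(sub_mem hc n h).2, le_abs_self (x - y)]
  exact this.continuous

end staircase

/-- The sequences `w`, `a`, `m` follow Nesterov's method with momentum parameter `s`, where `T`
is the gradient step map. -/
def IsNesterovRun (s : ℝ) (T : ℝ → ℝ) (w a m : ℕ → ℝ) : Prop :=
  ∀ t, m t = (w t + s * a t) / (s + 1) ∧ a (t + 1) = T (m t) ∧
    w (t + 1) = (1 - 1 / s) * w t + 1 / s * m t - s * (m t - T (m t))

namespace IsNesterovRun

variable {s c p δ : ℝ} {T : ℝ → ℝ} {w a m : ℕ → ℝ}

theorem add_three (hs : 1 < s) (hc : c = (s - 1) / (2 * s))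
    (hp : p = (s ^ 2 - 1) / (4 * s ^ 2)) (h : IsNesterovRun s T w a m) {r η ζ : ℝ} {k : ℕ}
    (hT₀ : ∀ x, |x - r| ≤ δ → T x = p * r)
    (hT₁ : ∀ x, |x| ≤ δ → T x = p * (4 * x))
    (hT₂ : ∀ x, |x + c ^ 2 * r| ≤ δ → T x = p * (4 * x + 3 * (c ^ 2 * r)))
    (ha : a k = r * ((s + 1) / (2 * s)) + η) (hw : w k = r * ((s + 1) / 2) + ζ)
    (hζ : |ζ| ≤ s * |η|) (hη : 2 * |η| ≤ δ) :
    a (k + 3) = -c ^ 3 * r * ((s + 1) / (2 * s)) + -16 * c ^ 3 * η ∧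
      w (k + 3) = -c ^ 3 * r * ((s + 1) / 2) + s / 2 * (-16 * c ^ 3 * η) := by
  have hs0 : 0 < s := by linarith
  have hs1 : 0 < s + 1 := by linarith
  obtain ⟨hm0, ha1, hw1⟩ := h k
  obtain ⟨hm1, ha2, hw2⟩ := h (k + 1)
  obtain ⟨hm2, ha3, hw3⟩ := h (k + 1 + 1)
  have e0 : m k = r + (ζ + s * η) / (s + 1) := by
    rw [hm0, ha, hw]; field_simp; ring
  have t0 : T (m k) = p * r := by
    refine hT₀ _ ?_
    rw [e0, add_sub_cancel_left, abs_div, abs_of_pos hs1, div_le_iff₀ hs1]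
    have := abs_add_le ζ (s * η)
    rw [abs_mul, abs_of_pos hs0] at this
    nlinarith [abs_nonneg η]
  rw [t0] at ha1 hw1
  have f1 : w (k + 1) = -(s * p * r) - (s - 1) * η := by
    rw [hw1, e0, hw, hp]; field_simp; ring
  have e1 : m (k + 1) = -((s - 1) / (s + 1) * η) := by
    rw [hm1, f1, ha1]; field_simp; ring
  have t1 : T (m (k + 1)) = p * (4 * m (k + 1)) := by
    refine hT₁ _ ?_
    have : (s - 1) / (s + 1) ≤ 1 := by rw [div_le_one hs1]; linarith
    have h0 : 0 ≤ (s - 1) / (s + 1) := div_nonneg (by linarith) hs1.le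
    rw [e1, abs_neg, abs_mul, abs_of_nonneg h0]
    nlinarith [abs_nonneg η]
  rw [t1, e1] at ha2 hw2
  have f2 : w (k + 1 + 1) = -((s + 1) * c ^ 2 * r) - (s - 1) ^ 2 / s * η := by
    rw [hw2, f1, hp, hc]; field_simp; ring
  have g2 : a (k + 1 + 1) = -((s - 1) ^ 2 / s ^ 2 * η) := by
    rw [ha2, hp]; field_simp; ring
  have e2 : m (k + 1 + 1) = -(c ^ 2 * r) - 2 * (s - 1) ^ 2 / (s * (s + 1)) * η := by
    rw [hm2, f2, g2, hc]; field_simp; ring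
  have t2 : T (m (k + 1 + 1)) = p * (4 * m (k + 1 + 1) + 3 * (c ^ 2 * r)) := by
    refine hT₂ _ ?_
    have h1 : 2 * (s - 1) ^ 2 / (s * (s + 1)) ≤ 2 := by
      rw [div_le_iff₀ (by positivity)]; nlinarith
    have h0 : 0 ≤ 2 * (s - 1) ^ 2 / (s * (s + 1)) := by positivity
    rw [e2, sub_add_eq_add_sub, neg_add_cancel, zero_sub, abs_neg, abs_mul, abs_of_nonneg h0]
    exact (mul_le_mul_of_nonneg_right h1 (abs_nonneg η)).trans hη
  rw [t2, e2] at ha3 hw3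
  constructor
  · rw [show k + 3 = k + 1 + 1 + 1 from rfl, ha3, hp, hc]; field_simp; ring
  · rw [show k + 3 = k + 1 + 1 + 1 from rfl, hw3, f2, hp, hc]; field_simp; ring

theorem three_mul (hs : 1 < s) (hc : c = (s - 1) / (2 * s))
    (hp : p = (s ^ 2 - 1) / (4 * s ^ 2)) (h : IsNesterovRun s T w a m) {K : ℕ} {η : ℝ}
    (hT : ∀ j < K, ∀ x,
      (|x - (-c ^ 3) ^ j| ≤ δ → T x = p * (-c ^ 3) ^ j) ∧
      (|x| ≤ δ → T x = p * (4 * x)) ∧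
      (|x + c ^ 2 * (-c ^ 3) ^ j| ≤ δ → T x = p * (4 * x + 3 * (c ^ 2 * (-c ^ 3) ^ j))))
    (ha : a 0 = (s + 1) / (2 * s) + η) (hw : w 0 = (s + 1) / 2)
    (hη : 2 * (2 ^ K * |η|) ≤ δ) {j : ℕ} (hj : j ≤ K) :
    a (3 * j) = (-c ^ 3) ^ j * ((s + 1) / (2 * s)) + (-16 * c ^ 3) ^ j * η ∧
      w (3 * j) = (-c ^ 3) ^ j * ((s + 1) / 2) +
        if j = 0 then 0 else s / 2 * ((-16 * c ^ 3) ^ j * η) := by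
  induction j with
  | zero => simp [ha, hw]
  | succ j ih =>
    obtain ⟨iha, ihw⟩ := ih (by omega)
    have hs0 : 0 < s := by linarith
    have hc0 : 0 ≤ c := by rw [hc]; exact div_nonneg (by linarith) (by linarith)
    have hc1 : c ≤ 1 / 2 := by
      rw [hc, div_le_div_iff₀ (by positivity) (by norm_num)]; linarith
    have hc3 : c ^ 3 ≤ (1 / 2) ^ 3 := by gcongr
    have hfac : |(-16 * c ^ 3) ^ j| ≤ 2 ^ K := by
      calc |(-16 * c ^ 3) ^ j| ≤ 2 ^ j := by
            rw [abs_pow]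
            gcongr
            rw [abs_mul, abs_of_nonneg (pow_nonneg hc0 3)]
            norm_num
            linarith
        _ ≤ 2 ^ K := pow_le_pow_right₀ (by norm_num) (by omega)
    have key := h.add_three hs hc hp (fun x => (hT j (by omega) x).1)
      (fun x => (hT j (by omega) x).2.1) (fun x => (hT j (by omega) x).2.2) iha ihw
      (by
        split_ifs
        · rw [abs_zero]; positivity
        · rw [abs_mul, abs_of_pos (half_pos hs0)]
          gcongr
          linarith)
      (by
        rw [abs_mul]
        refine le_trans ?_ hη
        gcongr)
    rw [if_neg (Nat.succ_ne_zero j), mul_add, mul_one, key.1, key.2]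
    constructor <;> ring

end IsNesterovRun

theorem agd_initial_value_instability
    (L μ : ℝ) (hμ : 0 < μ) (hL : 0 < L) (hcond : 25 ≤ L / μ)
    (K : ℕ) (hK : 1 ≤ K) :
    ∃ F : ℝ → ℝ, Differentiable ℝ F ∧
      (∀ u v : ℝ, F u ≤ F v + deriv F v * (u - v) + L / 2 * (u - v) ^ 2) ∧
      (∀ u v : ℝ, F v + deriv F v * (u - v) + μ / 2 * (u - v) ^ 2 ≤ F u) ∧
      ∃ ε₀ : ℝ, 0 < ε₀ ∧
        ∀ ε : ℝ, 0 < ε → ε < ε₀ →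
          ∃ w0 u0 wag0 uag0 : ℝ, |w0 - u0| ≤ ε ∧ |wag0 - uag0| ≤ ε ∧
            ∀ (w wag wmd u uag umd : ℕ → ℝ),
              w 0 = w0 → wag 0 = wag0 → u 0 = u0 → uag 0 = uag0 →
              (∀ t, wmd t = (1 / (Real.sqrt (L / μ) + 1)) * w t
                  + (Real.sqrt (L / μ) / (Real.sqrt (L / μ) + 1)) * wag t) →
              (∀ t, wag (t + 1) = wmd t - (1 / L) * deriv F (wmd t)) →
              (∀ t, w (t + 1) = (1 - 1 / Real.sqrt (L / μ)) * w t
                  + (1 / Real.sqrt (L / μ)) * wmd t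
                  - (1 / Real.sqrt (L * μ)) * deriv F (wmd t)) →
              (∀ t, umd t = (1 / (Real.sqrt (L / μ) + 1)) * u t
                  + (Real.sqrt (L / μ) / (Real.sqrt (L / μ) + 1)) * uag t) →
              (∀ t, uag (t + 1) = umd t - (1 / L) * deriv F (umd t)) →
              (∀ t, u (t + 1) = (1 - 1 / Real.sqrt (L / μ)) * u t
                  + (1 / Real.sqrt (L / μ)) * umd t
                  - (1 / Real.sqrt (L * μ)) * deriv F (umd t)) →
              (1 / 2) * ε * (1.02 : ℝ) ^ K ≤ |w (3 * K) - u (3 * K)| ∧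
              ε * (1.02 : ℝ) ^ K ≤ |wag (3 * K) - uag (3 * K)| := by
  obtain ⟨s, hs_def⟩ : ∃ s, s = Real.sqrt (L / μ) := ⟨_, rfl⟩
  have hs5 : 5 ≤ s := by
    rw [hs_def]
    exact Real.le_sqrt_of_sq_le (by norm_num; exact hcond)
  have hs0 : 0 < s := by linarith
  have hLs : L = μ * s ^ 2 := by
    rw [hs_def, Real.sq_sqrt (by positivity)]; field_simp
  have hLμ : Real.sqrt (L * μ) = μ * s := by
    rw [hLs, show μ * s ^ 2 * μ = (μ * s) ^ 2 by ring]
    exact Real.sqrt_sq (by positivity)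
  simp only [← hs_def, hLμ]
  clear hs_def hLμ hcond
  obtain ⟨c, hc⟩ : ∃ c, c = (s - 1) / (2 * s) := ⟨_, rfl⟩
  obtain ⟨p, hp⟩ : ∃ p, p = (s ^ 2 - 1) / (4 * s ^ 2) := ⟨_, rfl⟩
  have hc_low : 2 / 5 ≤ c := by
    rw [hc, div_le_div_iff₀ (by norm_num) (by positivity)]; linarith
  have hc_up : c ≤ 1 / 2 := by
    rw [hc, div_le_div_iff₀ (by positivity) (by norm_num)]; linarith
  have hc0 : 0 < c := by linarith
  have hp0 : 0 ≤ p := by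
    rw [hp]; exact div_nonneg (by nlinarith) (by positivity)
  have hμp : L * (1 - 4 * p) = μ := by rw [hLs, hp]; field_simp; ring
  obtain ⟨δ, hδ, hlocal⟩ := staircase.exists_local_form hc0 hc_up K
  set T : ℝ → ℝ := fun x => p * staircase c K x with hT_def
  have hT : Continuous T := continuous_const.mul (staircase.continuous hc0 K)
  have hf : Continuous fun x => L * (x - T x) := by fun_prop
  have hF : ∀ x, HasDerivAt (fun y => ∫ z in (0 : ℝ)..y, L * (z - T z)) (L * (x - T x)) x :=
    fun x => hf.integral_hasStrictDerivAt 0 x |>.hasDerivAt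
  refine ⟨fun y => ∫ z in (0 : ℝ)..y, L * (z - T z), fun x => (hF x).differentiableAt, ?_, ?_, ?_⟩
  · intro u v
    rw [(hF v).deriv]
    refine le_tangent_parabola hF (fun x y hxy => ?_) u v
    have := mul_le_mul_of_nonneg_left (staircase.sub_mem hc0 K hxy).1 hp0
    have := mul_le_mul_of_nonneg_left this hL.le
    simp only [hT_def]
    linarith
  · intro u v
    rw [(hF v).deriv]
    refine tangent_parabola_le hF (fun x y hxy => ?_) u v
    have := mul_le_mul_of_nonneg_left (staircase.sub_mem hc0 K hxy).2 hp0
    have := mul_le_mul_of_nonneg_left this hL.le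
    simp only [hT_def]
    rw [← hμp]
    linarith
  refine ⟨δ / (2 * 2 ^ K), by positivity, fun ε hε hεδ =>
    ⟨(s + 1) / 2, (s + 1) / 2, (s + 1) / (2 * s), (s + 1) / (2 * s) + ε, ?_, ?_, ?_⟩⟩
  · simpa using hε.le
  · simp [abs_of_pos hε]
  intro w wag wmd u uag umd hw0 hwag0 hu0 huag0 hwmd hwag hw humd huag hu
  have isRun : ∀ w a m : ℕ → ℝ,
      (∀ t, m t = 1 / (s + 1) * w t + s / (s + 1) * a t) →
      (∀ t, a (t + 1) =
        m t - 1 / L * deriv (fun y => ∫ z in (0 : ℝ)..y, L * (z - T z)) (m t)) →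
      (∀ t, w (t + 1) = (1 - 1 / s) * w t + 1 / s * m t -
        1 / (μ * s) * deriv (fun y => ∫ z in (0 : ℝ)..y, L * (z - T z)) (m t)) →
      IsNesterovRun s T w a m := by
    intro w a m hm ha hw t
    refine ⟨?_, ?_, ?_⟩
    · rw [hm]; ring
    · rw [ha, (hF _).deriv]; field_simp; ring
    · rw [hw, (hF _).deriv, hLs]; field_simp
  have hlocal' : ∀ j < K, ∀ x,
      (|x - (-c ^ 3) ^ j| ≤ δ → T x = p * (-c ^ 3) ^ j) ∧
      (|x| ≤ δ → T x = p * (4 * x)) ∧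
      (|x + c ^ 2 * (-c ^ 3) ^ j| ≤ δ → T x = p * (4 * x + 3 * (c ^ 2 * (-c ^ 3) ^ j))) :=
    fun j hj x => ⟨fun h => congrArg (p * ·) ((hlocal j hj x).1 h),
      fun h => congrArg (p * ·) ((hlocal j hj x).2.1 h),
      fun h => congrArg (p * ·) ((hlocal j hj x).2.2 h)⟩
  have hs1 : 1 < s := by linarith
  obtain ⟨hwagK, hwK⟩ := (isRun w wag wmd hwmd hwag hw).three_mul hs1 hc hp hlocal'
    (by rw [hwag0, add_zero]) hw0 (by simpa using hδ.le) le_rfl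
  rw [lt_div_iff₀ (by positivity)] at hεδ
  obtain ⟨huagK, huK⟩ := (isRun u uag umd humd huag hu).three_mul hs1 hc hp hlocal'
    huag0 hu0 (by rw [abs_of_pos hε]; linarith) le_rfl
  have hgrow : ε * 1.02 ^ K ≤ |(-16 * c ^ 3) ^ K * ε| := by
    have hc3 : (2 / 5) ^ 3 ≤ c ^ 3 := by gcongr
    rw [abs_mul, abs_pow, abs_of_pos hε, mul_comm, abs_mul, abs_of_pos (pow_pos hc0 3)]
    gcongr
    norm_num at hc3 ⊢
    linarith
  have hK0 : K ≠ 0 := by omega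
  rw [if_neg hK0] at hwK huK
  constructor
  · rw [hwK, huK, abs_sub_comm, mul_zero, mul_zero, add_zero, add_sub_cancel_left, abs_mul,
      abs_of_pos (half_pos hs0)]
    nlinarith [abs_nonneg ((-16 * c ^ 3) ^ K * ε)]
  · rwa [hwagK, huagK, abs_sub_comm, mul_zero, add_zero, add_sub_cancel_left]
end

section
/- Difference recursion for two coupled FedAc iterates (Claim B.9): Let F : ℝ^d → ℝ be twice continuously differentiable with μI ⪯ ∇²F(w) ⪯ LI for all w (μ > 0), and let α ≥ 1, β ≥ 1, η, γ > 0. Suppose two workers m₁, m₂ perform one unsynchronized FedAc step: for i = 1, 2, w_t^{md,i} = β⁻¹ w_t^i + (1 − β⁻¹) w_t^{ag,i}, w_{t+1}^{ag,i} = w_t^{md,i} − η(∇F(w_t^{md,i}) + ε_t^i) and w_{t+1}^i = (1 − α⁻¹) w_t^i + α⁻¹ w_t^{md,i} − γ(∇F(w_t^{md,i}) + ε_t^i), where ε_t^i ∈ ℝ^d are arbitrary noise vectors. Write Δ_t := w_t^1 − w_t^2, Δ_t^{ag} := w_t^{ag,1} − w_t^{ag,2}, Δ_t^{ε} := ε_t^1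 − ε_t^2. Then there exists a symmetric matrix H_t with μI ⪯ H_t ⪯ LI such that (Δ_{t+1}^{ag}; Δ_{t+1}) = [[ (1 − β⁻¹)(I − ηH_t) , β⁻¹(I − ηH_t) ], [ (1 − β⁻¹)(α⁻¹I − γH_t) , β⁻¹(α⁻¹I − γH_t) + (1 − α⁻¹)I ]] · (Δ_t^{ag}; Δ_t) − (ηI; γI) Δ_t^{ε}. -/
open MeasureTheory ProbabilityTheory Real
open scoped RealInnerProductSpace BigOperators

section HessianAverage

variable {E : Type*} [NormedAddCommGroup E] [InnerProductSpace ℝ E] [CompleteSpace E]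
  {F : E → ℝ} {gradF : E → E} {hessF : E → E →L[ℝ] E}

theorem inner_fderiv_gradient_comm (hgrad : ∀ x, HasGradientAt F (gradF x) x)
    {A : E →L[ℝ] E} {x : E} (hA : HasFDerivAt gradF A x) (v w : E) :
    ⟪A v, w⟫ = ⟪v, A w⟫ := by
  have hD : HasFDerivAt (fun y => InnerProductSpace.toDual ℝ E (gradF y))
      ((innerSL ℝ : E →L[ℝ] StrongDual ℝ E).comp A) x :=
    (innerSL ℝ : E →L[ℝ] StrongDual ℝ E).hasFDerivAt.comp x hA
  have h := second_derivative_symmetric (fun y => (hgrad y).hasFDerivAt) hD v w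
  simpa [real_inner_comm v] using h

theorem continuous_fderiv_gradient (hC2 : ContDiff ℝ 2 F)
    (hgrad : ∀ x, HasGradientAt F (gradF x) x) (hhess : ∀ x, HasFDerivAt gradF (hessF x) x) :
    Continuous hessF := by
  have hgradF : gradF = fun x => (InnerProductSpace.toDual ℝ E).symm (fderiv ℝ F x) := by
    funext x
    rw [(hgrad x).hasFDerivAt.fderiv, LinearIsometryEquiv.symm_apply_apply]
  have hC1 : ContDiff ℝ 1 gradF := by
    rw [hgradF]
    exact (InnerProductSpace.toDual ℝ E).symm.contDiff.comp
      (hC2.fderiv_right (m := 1) (by norm_num))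
  have hfderiv : hessF = fderiv ℝ gradF := funext fun x => (hhess x).fderiv.symm
  rw [hfderiv]
  exact hC1.continuous_fderiv one_ne_zero

/-- The average of the Hessian along a segment is a symmetric operator that inherits the quadratic
form bounds of the Hessian and maps the increment of the point to the increment of the gradient. -/
theorem exists_symmetric_map_sub_eq_gradient_sub {μ L : ℝ} (hC2 : ContDiff ℝ 2 F)
    (hgrad : ∀ x, HasGradientAt F (gradF x) x) (hhess : ∀ x, HasFDerivAt gradF (hessF x) x)
    (hlow : ∀ x v, μ * ‖v‖ ^ 2 ≤ ⟪hessF x v, v⟫)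
    (hupp : ∀ x v, ⟪hessF x v, v⟫ ≤ L * ‖v‖ ^ 2) (x y : E) :
    ∃ H : E →L[ℝ] E, (∀ v w, ⟪H v, w⟫ = ⟪v, H w⟫) ∧ (∀ v, μ * ‖v‖ ^ 2 ≤ ⟪H v, v⟫) ∧
      (∀ v, ⟪H v, v⟫ ≤ L * ‖v‖ ^ 2) ∧ H (x - y) = gradF x - gradF y := by
  have hcont : Continuous fun s : ℝ => hessF (y + s • (x - y)) :=
    (continuous_fderiv_gradient hC2 hgrad hhess).comp (by fun_prop)
  have hint := hcont.intervalIntegrable (μ := volume) 0 1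
  have hinner (v w : E) : ⟪(∫ s in (0 : ℝ)..1, hessF (y + s • (x - y))) v, w⟫ =
      ∫ s in (0 : ℝ)..1, ⟪hessF (y + s • (x - y)) v, w⟫ := by
    simpa [real_inner_comm w] using
      (((innerSL ℝ w).comp (ContinuousLinearMap.apply ℝ E v)).intervalIntegral_comp_comm hint).symm
  have hquad (v : E) :
      IntervalIntegrable (fun s : ℝ => ⟪hessF (y + s • (x - y)) v, v⟫) volume 0 1 :=
    ((hcont.clm_apply continuous_const).inner continuous_const).intervalIntegrable 0 1
  refine ⟨∫ s in (0 : ℝ)..1, hessF (y + s • (x - y)), fun v w => ?_, fun v => ?_, fun v => ?_, ?_⟩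
  · rw [← real_inner_comm v, hinner, hinner]
    congr 1 with s
    rw [inner_fderiv_gradient_comm hgrad (hhess _), real_inner_comm]
  · rw [hinner]
    simpa using intervalIntegral.integral_mono zero_le_one intervalIntegrable_const (hquad v)
      fun s => hlow (y + s • (x - y)) v
  · rw [hinner]
    simpa using intervalIntegral.integral_mono zero_le_one (hquad v) intervalIntegrable_const
      fun s => hupp (y + s • (x - y)) v
  · have hderiv (s : ℝ) : HasDerivAt (fun s : ℝ => gradF (y + s • (x - y)))
        (hessF (y + s • (x - y)) (x - y)) s := by
      refine (hhess _).comp_hasDerivAt s ?_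
      simpa using ((hasDerivAt_id s).smul_const (x - y)).const_add y
    rw [ContinuousLinearMap.intervalIntegral_apply hint,
      intervalIntegral.integral_eq_sub_of_hasDerivAt (fun s _ => hderiv s)
        ((hcont.clm_apply continuous_const).intervalIntegrable 0 1)]
    simp

end HessianAverage

theorem fedac_difference_recursion
    {d : ℕ} (μ L : ℝ) (hμ : 0 < μ) (hμL : μ ≤ L)
    (F : EuclideanSpace ℝ (Fin d) → ℝ) (gradF : EuclideanSpace ℝ (Fin d) → EuclideanSpace ℝ (Fin d))
    (hessF : EuclideanSpace ℝ (Fin d) → (EuclideanSpace ℝ (Fin d) →L[ℝ] EuclideanSpace ℝ (Fin d)))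
    (hC2 : ContDiff ℝ 2 F)
    (hgrad : ∀ x, HasGradientAt F (gradF x) x)
    (hhess : ∀ x, HasFDerivAt gradF (hessF x) x)
    (hlow : ∀ x v : EuclideanSpace ℝ (Fin d), μ * ‖v‖ ^ 2 ≤ ⟪hessF x v, v⟫)
    (hupp : ∀ x v : EuclideanSpace ℝ (Fin d), ⟪hessF x v, v⟫ ≤ L * ‖v‖ ^ 2)
    (α β η γ : ℝ) (hα : 1 ≤ α) (hβ : 1 ≤ β) (hη : 0 < η) (hγ : 0 < γ)
    (wt1 wt2 wag1 wag2 wmd1 wmd2 wt1' wt2' wag1' wag2' ε1 ε2 : EuclideanSpace ℝ (Fin d))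
    (hmd1 : wmd1 = β⁻¹ • wt1 + (1 - β⁻¹) • wag1)
    (hmd2 : wmd2 = β⁻¹ • wt2 + (1 - β⁻¹) • wag2)
    (hag1 : wag1' = wmd1 - η • (gradF wmd1 + ε1))
    (hag2 : wag2' = wmd2 - η • (gradF wmd2 + ε2))
    (hw1 : wt1' = (1 - α⁻¹) • wt1 + α⁻¹ • wmd1 - γ • (gradF wmd1 + ε1))
    (hw2 : wt2' = (1 - α⁻¹) • wt2 + α⁻¹ • wmd2 - γ • (gradF wmd2 + ε2)) :
    ∃ Ht : EuclideanSpace ℝ (Fin d) →L[ℝ] EuclideanSpace ℝ (Fin d),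
      (∀ x y : EuclideanSpace ℝ (Fin d), ⟪Ht x, y⟫ = ⟪x, Ht y⟫) ∧
      (∀ v : EuclideanSpace ℝ (Fin d), μ * ‖v‖ ^ 2 ≤ ⟪Ht v, v⟫) ∧
      (∀ v : EuclideanSpace ℝ (Fin d), ⟪Ht v, v⟫ ≤ L * ‖v‖ ^ 2) ∧
      wag1' - wag2' =
        (1 - β⁻¹) • ((wag1 - wag2) - η • Ht (wag1 - wag2))
          + β⁻¹ • ((wt1 - wt2) - η • Ht (wt1 - wt2))
          - η • (ε1 - ε2) ∧
      wt1' - wt2' =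
        (1 - β⁻¹) • (α⁻¹ • (wag1 - wag2) - γ • Ht (wag1 - wag2))
          + (β⁻¹ • (α⁻¹ • (wt1 - wt2) - γ • Ht (wt1 - wt2)) + (1 - α⁻¹) • (wt1 - wt2))
          - γ • (ε1 - ε2) := by
  obtain ⟨H, hsymm, hHlow, hHupp, hH⟩ :=
    exists_symmetric_map_sub_eq_gradient_sub hC2 hgrad hhess hlow hupp wmd1 wmd2
  have hmd : wmd1 - wmd2 = β⁻¹ • (wt1 - wt2) + (1 - β⁻¹) • (wag1 - wag2) := by
    rw [hmd1, hmd2]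
    module
  have hgradH : gradF wmd1 =
      gradF wmd2 + (β⁻¹ • H (wt1 - wt2) + (1 - β⁻¹) • H (wag1 - wag2)) := by
    rw [← map_smul, ← map_smul, ← map_add, ← hmd, hH, add_sub_cancel]
  refine ⟨H, hsymm, hHlow, hHupp, ?_, ?_⟩
  · rw [hag1, hag2, hgradH, hmd1, hmd2]
    module
  · rw [hw1, hw2, hgradH, hmd1, hmd2]
    module
end

section
/- Averaged gradient discrepancy bound under third-order smoothness (Lemma I.3): Let F : ℝ^d → ℝ be twice continuously differentiable and satisfy ‖∇F(u) − ∇F(w) − ∇²F(w)(u − w)‖ ≤ (Q/2)‖u − w‖² for all u, w ∈ ℝ^d (which holds when F is Q-third-order-smooth). Then for any points w¹, …, w^M ∈ ℝ^d with average w̄ := (1/M)Σ_{m=1}^M w^m, ‖ ∇F(w̄) − (1/M) Σ_{m=1}^M ∇F(w^m) ‖² ≤ (Q²/(4M)) Σ_{m=1}^M ‖w^m − w̄‖⁴. -/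
open MeasureTheory ProbabilityTheory Real
open scoped RealInnerProductSpace BigOperators

/-- The squared norm of an average is at most the average of the squared norms. -/
theorem norm_sq_average_le {E : Type*} [SeminormedAddCommGroup E] [NormedSpace ℝ E]
    (M : ℕ) (r : Fin M → E) :
    ‖(M : ℝ)⁻¹ • ∑ m, r m‖ ^ 2 ≤ (M : ℝ)⁻¹ * ∑ m, ‖r m‖ ^ 2 := by
  rcases Nat.eq_zero_or_pos M with rfl | hM
  · simp
  have hM' : (0 : ℝ) < M := Nat.cast_pos.mpr hM
  have hsum : ‖∑ m, r m‖ ^ 2 ≤ M * ∑ m, ‖r m‖ ^ 2 :=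
    calc ‖∑ m, r m‖ ^ 2 ≤ (∑ m, ‖r m‖) ^ 2 := by gcongr; exact norm_sum_le _ _
      _ ≤ M * ∑ m, ‖r m‖ ^ 2 := by
        simpa using sq_sum_le_card_mul_sum_sq (s := Finset.univ) (f := fun m => ‖r m‖)
  calc ‖(M : ℝ)⁻¹ • ∑ m, r m‖ ^ 2 = ((M : ℝ)⁻¹) ^ 2 * ‖∑ m, r m‖ ^ 2 := by
        rw [norm_smul, mul_pow, Real.norm_of_nonneg (inv_nonneg.mpr hM'.le)]
    _ ≤ ((M : ℝ)⁻¹) ^ 2 * (M * ∑ m, ‖r m‖ ^ 2) := by gcongr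
    _ = (M : ℝ)⁻¹ * ∑ m, ‖r m‖ ^ 2 := by field_simp

theorem averaged_gradient_discrepancy
    {d : ℕ} (Q : ℝ)
    (F : EuclideanSpace ℝ (Fin d) → ℝ) (gradF : EuclideanSpace ℝ (Fin d) → EuclideanSpace ℝ (Fin d))
    (hessF : EuclideanSpace ℝ (Fin d) → (EuclideanSpace ℝ (Fin d) →L[ℝ] EuclideanSpace ℝ (Fin d)))
    (hC2 : ContDiff ℝ 2 F)
    (hgrad : ∀ x, HasGradientAt F (gradF x) x)
    (hhess : ∀ x, HasFDerivAt gradF (hessF x) x)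
    (hQ : ∀ u v : EuclideanSpace ℝ (Fin d), ‖gradF u - gradF v - hessF v (u - v)‖ ≤ Q / 2 * ‖u - v‖ ^ 2)
    (M : ℕ) (hM : 0 < M) (w : Fin M → EuclideanSpace ℝ (Fin d)) :
    ‖gradF ((M : ℝ)⁻¹ • ∑ m : Fin M, w m) - (M : ℝ)⁻¹ • (∑ m : Fin M, gradF (w m))‖ ^ 2
      ≤ Q ^ 2 / (4 * M) * ∑ m : Fin M, ‖w m - (M : ℝ)⁻¹ • (∑ m' : Fin M, w m')‖ ^ 4 := by
  have hM' : (M : ℝ) ≠ 0 := Nat.cast_ne_zero.mpr hM.ne'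
  set c := (M : ℝ)⁻¹ • ∑ m : Fin M, w m with hc
  have hcM : (M : ℝ) • c = ∑ m, w m := by rw [hc, smul_inv_smul₀ hM']
  have hcentered : ∑ m, (w m - c) = 0 := by
    rw [Finset.sum_sub_distrib, Finset.sum_const, Finset.card_univ, Fintype.card_fin,
      ← Nat.cast_smul_eq_nsmul ℝ, hcM, sub_self]
  have hremainder : (M : ℝ)⁻¹ • ∑ m, (gradF (w m) - gradF c - hessF c (w m - c))
      = (M : ℝ)⁻¹ • ∑ m, gradF (w m) - gradF c := by
    rw [Finset.sum_sub_distrib, ← map_sum, hcentered, map_zero, sub_zero,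
      Finset.sum_sub_distrib, Finset.sum_const, Finset.card_univ, Fintype.card_fin,
      ← Nat.cast_smul_eq_nsmul ℝ, smul_sub, inv_smul_smul₀ hM']
  rw [norm_sub_rev, ← hremainder]
  calc _ ≤ (M : ℝ)⁻¹ * ∑ m, ‖gradF (w m) - gradF c - hessF c (w m - c)‖ ^ 2 :=
        norm_sq_average_le M _
    _ ≤ (M : ℝ)⁻¹ * ∑ m, (Q / 2 * ‖w m - c‖ ^ 2) ^ 2 := by
        gcongr with m
        exact hQ (w m) c
    _ = Q ^ 2 / (4 * M) * ∑ m, ‖w m - c‖ ^ 4 := by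
        rw [Finset.mul_sum, Finset.mul_sum]
        refine Finset.sum_congr rfl fun m _ => ?_
        field_simp
        ring
end
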